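/- arXiv:1105.1329 — 3 statements merged into one kernel-verified Lean document; each statement's English description precedes it below -/
import Mathlib

section
/- Let G be a finite tree on a vertex set V with at least 3 vertices, let X be a type, and let S : V → Set X be a family of sets indexed by the vertices. Suppose that (i) for every vertex v of G of degree at least 2 the set S v has exactly one element, and (ii) for every edge {u, v} of G the intersection S u ∩ S v is nonempty. Then the total intersection ⋂_{v ∈ V} S v has exactly one element. -/
/-- A finite tree with at least three vertices has a vertex of degree at least two. -/
theorem SimpleGraph.IsTree.exists_two_le_degree {V : Type*} [Fintype V]
    {G : SimpleGraph V} [DecidableRel G.Adj] (hT : G.IsTree) (hV : 3 ≤ Fintype.card V) :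
    ∃ v, 2 ≤ G.degree v := by
  by_contra! h
  have hcard := hT.card_edgeFinset
  have hsum := G.sum_degrees_eq_twice_card_edges
  have hle : ∑ v, G.degree v ≤ ∑ _v : V, 1 :=
    Finset.sum_le_sum fun v _ => Nat.lt_succ_iff.mp (h v)
  simp only [Finset.sum_const, Finset.card_univ, smul_eq_mul, mul_one] at hle
  omega

/-- Combinatorial core of Lemma 2: if `G` is a finite tree on at least 3 vertices,
each set attached to a vertex of degree ≥ 2 is a singleton, and the sets attached to
the endpoints of every edge intersect, then the total intersection is a singleton. -/
theorem tree_intersection_unique {V X : Type*} [Fintype V]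
    (G : SimpleGraph V) [DecidableRel G.Adj]
    (hT : G.IsTree) (hV : 3 ≤ Fintype.card V)
    (S : V → Set X)
    (hdeg : ∀ v : V, 2 ≤ G.degree v → ∃ x : X, S v = {x})
    (hedge : ∀ u v : V, G.Adj u v → (S u ∩ S v).Nonempty) :
    ∃ x : X, (⋂ v : V, S v) = {x} := by
  obtain ⟨r, hr⟩ := hT.exists_two_le_degree hV
  obtain ⟨x, hx⟩ := hdeg r hr
  have spread : ∀ u w, 2 ≤ G.degree u → x ∈ S u → G.Adj u w → x ∈ S w := by
    intro u w hu hxu huw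
    obtain ⟨y, hy⟩ := hdeg u hu
    obtain ⟨z, hzu, hzw⟩ := hedge u w huw
    rw [hy, Set.mem_singleton_iff] at hzu hxu
    rwa [hxu, ← hzu]
  have hxr : x ∈ S r := by simp [hx]
  have key : ∀ v, x ∈ S v ∧ ∀ w, G.Adj v w → x ∈ S w := by
    intro v
    have hreach := (SimpleGraph.reachable_iff_reflTransGen r v).mp (hT.connected.preconnected r v)
    induction hreach with
    | refl => exact ⟨hxr, fun w => spread r w hr hxr⟩
    | @tail u v _ huv ih =>
      refine ⟨ih.2 v huv, fun w hvw => ?_⟩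
      by_cases hv : 2 ≤ G.degree v
      · exact spread v w hv (ih.2 v huv) hvw
      · have hcard : (G.neighborFinset v).card ≤ 1 := by
          rw [G.card_neighborFinset_eq_degree]
          omega
        have hwu : w = u := Finset.card_le_one.mp hcard w (by simpa using hvw) u
          (by simpa using huv.symm)
        exact hwu ▸ ih.1
  refine ⟨x, Set.Subset.antisymm ?_ ?_⟩
  · exact hx ▸ Set.iInter_subset S r
  · exact Set.singleton_subset_iff.mpr (Set.mem_iInter.mpr fun v => (key v).1)
end

section
/- For every field K and every natural number n, the ring of formal power series in n variables over K, MvPowerSeries (Fin n) K, is a unique factorization domain. -/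
/-- A nonempty set of exponents has an element of strictly minimal weight for a suitable weight
which is `1` on the first variable. -/
theorem exists_weight_strict_min (n : ℕ) (S : Set (Fin (n + 1) → ℕ)) (hS : S.Nonempty) :
    ∃ w : Fin (n + 1) → ℕ, w 0 = 1 ∧ (∀ i, w i ≠ 0) ∧
      ∃ d ∈ S, ∀ d' ∈ S, d' ≠ d → ∑ i, d i * w i < ∑ i, d' i * w i := by
  induction n with
  | zero =>
    obtain ⟨d, hd, hmin⟩ := exists_minimal_of_wellFoundedLT (· ∈ S) hS
    refine ⟨1, rfl, by simp, d, hd, fun d' hd' hne ↦ ?_⟩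
    have h0 : d' 0 ≠ d 0 := fun h ↦ hne (funext fun i ↦ by rwa [Fin.fin_one_eq_zero i])
    have h1 : ¬ d' 0 ≤ d 0 := fun h ↦ h0 <| h.antisymm <|
      hmin hd' (fun i ↦ by rwa [Fin.fin_one_eq_zero i]) 0
    simpa using h1
  | succ n ih =>
    obtain ⟨d₀, hd₀, hmin⟩ := WellFounded.has_min
      (InvImage.wf (fun d : Fin (n + 2) → ℕ ↦ d (Fin.last _)) wellFounded_lt) S hS
    replace hmin : ∀ d ∈ S, d₀ (Fin.last _) ≤ d (Fin.last _) := fun d hd ↦ not_lt.1 (hmin d hd)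
    obtain ⟨w, hw0, hw, e, ⟨d, ⟨hd, hdl⟩, rfl⟩, hlt⟩ := ih
      (Set.image Fin.init {d ∈ S | d (Fin.last _) = d₀ (Fin.last _)})
      ⟨_, d₀, ⟨hd₀, rfl⟩, rfl⟩
    refine ⟨Fin.snoc w (∑ i, Fin.init d i * w i + 1), ?_, ?_, d, hd, fun d' hd' hne ↦ ?_⟩
    · rw [← Fin.castSucc_zero, Fin.snoc_castSucc, hw0]
    · intro i
      refine Fin.lastCases (by simp) (fun i ↦ by simpa using hw i) i
    · simp only [Fin.sum_univ_castSucc (n := n + 1), Fin.snoc_castSucc, Fin.snoc_last]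
      change ∑ i, Fin.init d i * w i + _ < ∑ i, Fin.init d' i * w i + _
      rcases (hmin d' hd').eq_or_lt with h | h
      · have := hlt (Fin.init d') ⟨d', ⟨hd', h.symm⟩, rfl⟩ fun he ↦ hne <| by
          rw [← Fin.snoc_init_self d, ← Fin.snoc_init_self d', he, hdl, h]
        rw [← h, hdl]
        omega
      · rw [hdl]
        have := Nat.mul_le_mul_right (∑ i, Fin.init d i * w i + 1) (Nat.succ_le_of_lt h)
        rw [Nat.succ_mul] at this
        omega

namespace PowerSeries

open Polynomial IsLocalRing

/-- Over a complete local factorial ring, an irreducible power series with nonzero reduction is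
prime. -/
theorem prime_of_irreducible_of_map_residue_ne_zero {A : Type*} [CommRing A] [IsDomain A]
    [IsLocalRing A] [IsAdicComplete (maximalIdeal A) A] [UniqueFactorizationMonoid A]
    {g : A⟦X⟧} (hg : Irreducible g) (hg0 : g.map (residue A) ≠ 0) : Prime g := by
  obtain ⟨f, h, H⟩ := exists_isWeierstrassFactorization hg0
  have hfirr : Irreducible (f : A⟦X⟧) :=
    (irreducible_mul_isUnit H.isUnit).1 (H.eq_mul ▸ hg)
  have eq_one (a b : A[X]) (ha : a.Monic) (hab : a * b = f) (hu : IsUnit (a : A⟦X⟧)) : a = 1 := by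
    have hdvd : a.map (residue A) ∣ Polynomial.X ^ f.natDegree := by
      have hX : f.map (residue A) = Polynomial.X ^ f.natDegree :=
        H.isDistinguishedAt.map_eq_X_pow
      rw [← hX, ← hab, Polynomial.map_mul]
      exact dvd_mul_right _ _
    obtain ⟨i, -, hi⟩ := (dvd_prime_pow Polynomial.prime_X _).1 hdvd
    replace hi := eq_of_monic_of_associated (ha.map _) (monic_X_pow i) hi
    have hu0 : (a.map (residue A)).coeff 0 ≠ 0 := by
      rw [Polynomial.coeff_map, ← Polynomial.coeff_coe, coeff_zero_eq_constantCoeff_apply]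
      exact ((isUnit_iff_constantCoeff.1 hu).map (residue A)).ne_zero
    have hi0 : i = 0 := by
      rw [hi, Polynomial.coeff_X_pow] at hu0
      by_contra hne
      exact hu0 (if_neg (Ne.symm hne))
    refine (Monic.natDegree_eq_zero ha).1 ?_
    rw [← ha.natDegree_map (residue A), hi, hi0, pow_zero, natDegree_one]
  have hf : Irreducible f := by
    refine (irreducible_of_monic H.isDistinguishedAt.monic ?_).2 fun a b ha hb hab ↦ ?_
    · rintro rfl
      exact hfirr.not_isUnit (by simp)
    · rcases hfirr.isUnit_or_isUnit (a := (a : A⟦X⟧)) (b := (b : A⟦X⟧))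
        (by rw [← hab, Polynomial.coe_mul]) with hu | hu
      · exact .inl (eq_one a b ha hab hu)
      · exact .inr (eq_one b a hb (mul_comm b a ▸ hab) hu)
  have : (Ideal.span {f}).IsPrime := (Ideal.span_singleton_prime hf.ne_zero).2 hf.prime
  have : IsDomain (A⟦X⟧ ⧸ Ideal.span {g}) := H.algEquivQuotient.symm.toMulEquiv.isDomain _
  exact (Ideal.span_singleton_prime hg.ne_zero).1 ((Ideal.Quotient.isDomain_iff_prime _).1 this)

end PowerSeries

namespace MvPowerSeries

theorem mem_span_range_X_iff_constantCoeff {K : Type*} [CommRing K] (n : ℕ)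
    (f : MvPowerSeries (Fin n) K) :
    f ∈ Ideal.span (Set.range X) ↔ constantCoeff f = 0 := by
  constructor
  · intro hf
    rw [← RingHom.mem_ker]
    refine Ideal.span_le.2 ?_ hf
    rintro _ ⟨i, rfl⟩
    simp
  induction n with
  | zero =>
    intro hf
    have : f = 0 := by
      ext d
      rw [Subsingleton.elim d 0, coeff_zero_eq_constantCoeff_apply, hf, map_zero]
    simp [this]
  | succ n ih =>
    intro hf
    set e := finSuccEquiv K n
    have h0 : constantCoeff (PowerSeries.constantCoeff (e f)) = 0 := by
      rw [← PowerSeries.coeff_zero_eq_constantCoeff_apply, ← coeff_zero_eq_constantCoeff_apply,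
        coeff_coeff_finSuccEquiv, Finsupp.cons_zero_zero, coeff_zero_eq_constantCoeff_apply, hf]
    have h1 : ∀ g ∈ Ideal.span (Set.range (X (σ := Fin n) (R := K))),
        e.symm (PowerSeries.C g) ∈ Ideal.span (Set.range (X (σ := Fin (n + 1)) (R := K))) := by
      intro g hg
      change g ∈ (Ideal.span _).comap
        ((e.symm : _ →+* MvPowerSeries (Fin (n + 1)) K).comp PowerSeries.C)
      refine Ideal.span_le.2 ?_ hg
      rintro _ ⟨i, rfl⟩
      refine Ideal.subset_span ⟨i.succ, ?_⟩
      rw [← e.symm_apply_apply (X i.succ), finSuccEquiv_X_succ]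
      rfl
    rw [← e.symm_apply_apply f, PowerSeries.eq_X_mul_shift_add_const (e f), map_add, map_mul]
    refine add_mem (Ideal.mul_mem_right _ _ (Ideal.subset_span ⟨0, ?_⟩)) (h1 _ (ih _ h0))
    rw [← e.symm_apply_apply (X 0), finSuccEquiv_X_zero]

instance isAdicComplete_maximalIdeal {K : Type*} [Field K] (n : ℕ) :
    IsAdicComplete (IsLocalRing.maximalIdeal (MvPowerSeries (Fin n) K))
      (MvPowerSeries (Fin n) K) := by
  have : IsLocalRing.maximalIdeal (MvPowerSeries (Fin n) K) = Ideal.span (Set.range X) := by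
    ext f
    rw [mem_span_range_X_iff_constantCoeff, IsLocalRing.mem_maximalIdeal, mem_nonunits_iff,
      isUnit_iff_constantCoeff, isUnit_iff_ne_zero, not_not]
  rw [this]
  infer_instance

/-- The substitution fixing `X 0` and sending `X i` to `X i + c * X 0 ^ w i` for `i ≠ 0`. -/
noncomputable def shear {K : Type*} [CommRing K] {n : ℕ} (w : Fin (n + 1) → ℕ) (c : K)
    (i : Fin (n + 1)) : MvPowerSeries (Fin (n + 1)) K :=
  if i = 0 then X 0 else X i + C c * X 0 ^ w i

section shear

variable {K : Type*} [CommRing K] {n : ℕ} {w : Fin (n + 1) → ℕ}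

theorem hasSubst_shear (hw : ∀ i, w i ≠ 0) (c : K) : HasSubst (shear w c) := by
  refine hasSubst_of_constantCoeff_zero fun i ↦ ?_
  unfold shear
  split_ifs <;> simp [hw]

theorem subst_shear_neg_shear (hw : ∀ i, w i ≠ 0) (c : K) (f : MvPowerSeries (Fin (n + 1)) K) :
    subst (shear w (-c)) (subst (shear w c) f) = f := by
  have hs := hasSubst_shear hw (-c)
  have h0 : subst (shear w (-c)) (X 0 : MvPowerSeries (Fin (n + 1)) K) = X 0 := by
    rw [subst_X hs, shear, if_pos rfl]
  rw [subst_comp_subst_apply (hasSubst_shear hw c) hs]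
  suffices (fun i ↦ subst (shear w (-c)) (shear w c i)) = X by rw [this, subst_self, id]
  funext i
  by_cases hi : i = 0
  · rw [hi, shear, if_pos rfl, h0]
  · rw [shear, if_neg hi, subst_add hs, subst_mul hs, subst_pow hs, h0, subst_X hs, subst_C,
      shear, if_neg hi]
    simp

/-- The substitution by `shear` as an automorphism. -/
noncomputable def shearEquiv (hw : ∀ i, w i ≠ 0) (c : K) :
    MvPowerSeries (Fin (n + 1)) K ≃ₐ[K] MvPowerSeries (Fin (n + 1)) K :=
  AlgEquiv.ofAlgHom (substAlgHom (hasSubst_shear hw c)) (substAlgHom (hasSubst_shear hw (-c)))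
    (by
      ext1 f
      have := subst_shear_neg_shear hw (-c) f
      rw [neg_neg] at this
      simpa [coe_substAlgHom] using this)
    (by
      ext1 f
      simpa [coe_substAlgHom] using subst_shear_neg_shear hw c f)

/-- Restriction of a power series to the axis of the variable `X 0`. -/
noncomputable def restrictAxis (K : Type*) [CommRing K] (n : ℕ) :
    MvPowerSeries (Fin (n + 1)) K →+* PowerSeries K :=
  (PowerSeries.map constantCoeff).comp
    (finSuccEquiv K n : _ →+* PowerSeries (MvPowerSeries (Fin n) K))

theorem coeff_restrictAxis (f : MvPowerSeries (Fin (n + 1)) K) (N : ℕ) :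
    PowerSeries.coeff N (restrictAxis K n f) = coeff (Finsupp.cons N 0) f := by
  rw [← coeff_coeff_finSuccEquiv]
  rfl

theorem restrictAxis_shear_one (hw0 : w 0 = 1) (i : Fin (n + 1)) :
    restrictAxis K n (shear w 1 i) = PowerSeries.X ^ w i := by
  have h0 : restrictAxis K n (X 0) = PowerSeries.X := by
    simp [restrictAxis, finSuccEquiv_X_zero]
  refine Fin.cases ?_ (fun i ↦ ?_) i
  · rw [shear, if_pos rfl, h0, hw0, pow_one]
  · have h1 : restrictAxis K n (X i.succ) = 0 := by
      simp [restrictAxis, finSuccEquiv_X_succ]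
    rw [shear, if_neg i.succ_ne_zero, map_one, one_mul, map_add, map_pow, h0, h1, zero_add]

/-- Every nonzero power series becomes regular in the variable `X 0` after a shear. -/
theorem exists_restrictAxis_ne_zero {f : MvPowerSeries (Fin (n + 1)) K} (hf : f ≠ 0) :
    ∃ e : MvPowerSeries (Fin (n + 1)) K ≃ₐ[K] MvPowerSeries (Fin (n + 1)) K,
      restrictAxis K n (e f) ≠ 0 := by
  obtain ⟨d₀, hd₀⟩ := (ne_zero_iff_exists_coeff_ne_zero f).1 hf
  obtain ⟨w, hw0, hw, d, hd, hmin⟩ := exists_weight_strict_min n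
    {d | coeff (Finsupp.equivFunOnFinite.symm d) f ≠ 0} ⟨d₀, by simpa using hd₀⟩
  refine ⟨shearEquiv hw 1, fun h ↦ hd ?_⟩
  have key (k : Fin (n + 1) →₀ ℕ) (N : ℕ) :
      coeff (Finsupp.cons N 0) (k.prod fun i m ↦ shear w (1 : K) i ^ m) =
        if N = ∑ i, k i * w i then 1 else 0 := by
    rw [← coeff_restrictAxis, Finsupp.prod_fintype _ _ (by simp), map_prod,
      ← PowerSeries.coeff_X_pow, ← Finset.prod_pow_eq_pow_sum]
    simp_rw [map_pow, restrictAxis_shear_one hw0, ← pow_mul, mul_comm]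
  have hc := coeff_restrictAxis (shearEquiv hw 1 f) (∑ i, d i * w i)
  rw [h, map_zero] at hc
  change 0 = coeff _ (substAlgHom (hasSubst_shear hw 1) f) at hc
  rw [coe_substAlgHom, coeff_subst (hasSubst_shear hw 1),
    finsum_eq_single _ (Finsupp.equivFunOnFinite.symm d)] at hc
  · rw [key] at hc
    simpa using hc.symm
  · intro k hk
    by_cases hkf : coeff k f = 0
    · rw [hkf, zero_smul]
    · have := hmin k (by simpa using hkf) fun h ↦ hk (by simp [← h])
      rw [key, if_neg this.ne, smul_zero]

end shear

theorem prime_of_irreducible {K : Type*} [Field K] (n : ℕ) {f : MvPowerSeries (Fin n) K}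
    (hf : Irreducible f) : Prime f := by
  induction n with
  | zero =>
    have e := (isEmptyEquiv (Fin 0) K).toMulEquiv
    rw [← MulEquiv.prime_iff e]
    exact ((MulEquiv.irreducible_iff e).2 hf).prime
  | succ n ih =>
    have : IsDomain (MvPowerSeries (Fin n) K) := NoZeroDivisors.to_isDomain _
    have : UniqueFactorizationMonoid (MvPowerSeries (Fin n) K) :=
      { irreducible_iff_prime := ⟨ih, Prime.irreducible⟩ }
    obtain ⟨e, he⟩ := exists_restrictAxis_ne_zero hf.ne_zero
    rw [← MulEquiv.prime_iff (e.trans (finSuccEquiv K n)).toMulEquiv]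
    refine PowerSeries.prime_of_irreducible_of_map_residue_ne_zero
      ((MulEquiv.irreducible_iff (e.trans (finSuccEquiv K n)).toMulEquiv).2 hf) fun h ↦ he ?_
    ext N
    have hN := congrArg (PowerSeries.coeff N) h
    rw [PowerSeries.coeff_map, map_zero, IsLocalRing.residue_eq_zero_iff,
      IsLocalRing.mem_maximalIdeal, mem_nonunits_iff, isUnit_iff_constantCoeff,
      isUnit_iff_ne_zero, not_not] at hN
    simpa [restrictAxis] using hN

end MvPowerSeries

/-- The ring of formal power series in `n` variables over a field `K` is a
unique factorization domain. -/
theorem mvPowerSeries_ufd (K : Type*) [Field K] (n : ℕ) :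
    letI : IsDomain (MvPowerSeries (Fin n) K) := NoZeroDivisors.to_isDomain _
    UniqueFactorizationMonoid (MvPowerSeries (Fin n) K) := by
  have : IsDomain (MvPowerSeries (Fin n) K) := NoZeroDivisors.to_isDomain _
  exact { irreducible_iff_prime := ⟨MvPowerSeries.prime_of_irreducible n, Prime.irreducible⟩ }
end

section
/- Let f be a polynomial over the formal power series ring ℂ[[t]] and let y, z ∈ ℂ[[t]] satisfy f(y) = 0 and f(z) = 0 (evaluation of f at y and z in ℂ[[t]]). Suppose f′(y) ≠ 0, where f′ is the formal derivative of f, and let e be the t-adic order of f′(y). If t^(e+1) divides y − z in ℂ[[t]], then y = z. -/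
/-- The difference of two distinct roots of a polynomial over a domain divides the derivative
at either root. -/
theorem Polynomial.sub_dvd_eval_derivative_of_isRoot {R : Type*} [CommRing R] [IsDomain R]
    {f : Polynomial R} {x y : R} (hx : f.IsRoot x) (hy : f.IsRoot y) (hxy : x ≠ y) :
    x - y ∣ f.derivative.eval x := by
  obtain ⟨k, hk⟩ := f.binomExpansion x (y - x)
  rw [add_sub_cancel, hx.eq_zero, hy.eq_zero] at hk
  refine ⟨k, mul_right_cancel₀ (sub_ne_zero.mpr hxy.symm) ?_⟩
  linear_combination -hk


/-- A simple root of a polynomial over `ℂ[[t]]` is determined by its jet of order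
`e + 1`, where `e` is the `t`-adic order of the derivative at the root: if `y`, `z`
are roots of `f`, the derivative of `f` does not vanish at `y` and has order `e`
there, and `t^(e+1)` divides `y - z`, then `y = z`. -/
theorem simple_root_determined_by_jet (f : Polynomial (PowerSeries ℂ))
    (y z : PowerSeries ℂ)
    (hy : Polynomial.eval y f = 0) (hz : Polynomial.eval z f = 0)
    (hd : Polynomial.eval y (Polynomial.derivative f) ≠ 0)
    (e : ℕ) (he : (Polynomial.eval y (Polynomial.derivative f)).order = e)
    (hdvd : (PowerSeries.X : PowerSeries ℂ) ^ (e + 1) ∣ y - z) :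
    y = z := by
  by_contra hyz
  have h := hdvd.trans (Polynomial.sub_dvd_eval_derivative_of_isRoot hy hz hyz)
  exact (PowerSeries.order_eq_nat.mp he).1 (PowerSeries.X_pow_dvd_iff.mp h e e.lt_succ_self)
end
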